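/- Dominating pair of datasets for the Poisson-subsampled Gaussian mechanism under the add relation: let σ > 0 and γ ∈ [0,1]. For every pair of finite tuples D, D' with all entries in [−1,1] such that D' is obtained from D by inserting one additional entry, and every α ≥ 0, H_α(Mγ(D) ‖ Mγ(D')) ≤ H_α(N(0,σ²) ‖ (1−γ)·N(0,σ²) + γ·N(1,σ²)). Moreover this bound is realized: for D = (0,…,0) and D' = (0,…,0,1), Mγ(D) = N(0,σ²) and Mγ(D') = (1−γ)·N(0,σ²) + γ·N(1,σ²). -/

import Mathlib

open MeasureTheory ProbabilityTheory

/-- Hockey-stick divergence: `H_α(P ‖ Q) = sup_{E measurable} (P(E) − α·Q(E))`. -/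
noncomputable def hsDiv {X : Type*} [MeasurableSpace X] (α : ℝ) (P Q : Measure X) : ℝ :=
  ⨆ E : {E : Set X // MeasurableSet E}, ((P E).toReal - α * (Q E).toReal)

/-- The Poisson-subsampled Gaussian mechanism:
`Mγ(x) = ∑_{S ⊆ [m]} γ^{|S|} (1−γ)^{m−|S|} · N(∑_{i∈S} x_i, σ²)`. -/
noncomputable def poissonGauss (σ γ : ℝ) {m : ℕ} (x : Fin m → ℝ) : Measure ℝ :=
  ∑ S : Finset (Fin m),
    ENNReal.ofReal (γ ^ S.card * (1 - γ) ^ (m - S.card)) •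
      gaussianReal (∑ i ∈ S, x i) ⟨σ ^ 2, sq_nonneg σ⟩

open scoped ENNReal NNReal

section HockeyStick

variable {X Y : Type*} [MeasurableSpace X] [MeasurableSpace Y]

lemma bddAbove_range_hsDiv {α : ℝ} (hα : 0 ≤ α) (P Q : Measure X) [IsFiniteMeasure P] :
    BddAbove (Set.range fun E : {E : Set X // MeasurableSet E} =>
      (P E).toReal - α * (Q E).toReal) := by
  refine ⟨P.real Set.univ, ?_⟩
  rintro _ ⟨E, rfl⟩
  have h₁ : (P E).toReal ≤ P.real Set.univ := measureReal_mono (Set.subset_univ _)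
  have h₂ : 0 ≤ α * (Q E).toReal := by positivity
  exact (sub_le_self _ h₂).trans h₁

lemma le_hsDiv {α : ℝ} (hα : 0 ≤ α) (P Q : Measure X) [IsFiniteMeasure P]
    {E : Set X} (hE : MeasurableSet E) : P.real E - α * Q.real E ≤ hsDiv α P Q :=
  le_ciSup (bddAbove_range_hsDiv hα P Q) ⟨E, hE⟩

lemma integral_sub_le_hsDiv {α : ℝ} (hα : 0 ≤ α) (P Q : Measure X) [IsFiniteMeasure P]
    [IsFiniteMeasure Q] {f : X → ℝ} (hf : Measurable f) (hf0 : ∀ x, 0 ≤ f x)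
    (hf1 : ∀ x, f x ≤ 1) : ∫ x, f x ∂P - α * ∫ x, f x ∂Q ≤ hsDiv α P Q := by
  have hint (R : Measure X) [IsFiniteMeasure R] : Integrable f R :=
    .of_bound hf.aestronglyMeasurable 1 (.of_forall fun x => by
      rw [Real.norm_eq_abs, abs_of_nonneg (hf0 x)]; exact hf1 x)
  have hlevel (R : Measure X) [IsFiniteMeasure R] :
      IntegrableOn (fun t => R.real {x | t ≤ f x}) (Set.Ioc 0 1) := by
    have hanti : Antitone fun t => R.real {x | t ≤ f x} := fun s t hst =>
      measureReal_mono fun x (hx : t ≤ f x) => hst.trans hx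
    exact (hanti.locallyIntegrable.integrableOn_isCompact isCompact_Icc).mono_set
      Set.Ioc_subset_Icc_self
  rw [(hint P).integral_eq_integral_Ioc_meas_le (.of_forall hf0) (.of_forall hf1),
    (hint Q).integral_eq_integral_Ioc_meas_le (.of_forall hf0) (.of_forall hf1),
    ← integral_const_mul, ← integral_sub (hlevel P) ((hlevel Q).const_mul α)]
  calc _ ≤ ∫ _ in Set.Ioc (0 : ℝ) 1, hsDiv α P Q :=
        integral_mono ((hlevel P).sub ((hlevel Q).const_mul α)) (integrable_const _)
          fun t => le_hsDiv hα P Q (measurableSet_le measurable_const hf)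
    _ = hsDiv α P Q := by simp

/-- Data processing inequality for the hockey-stick divergence. -/
lemma hsDiv_map_prod_le {α : ℝ} (hα : 0 ≤ α) (P Q : Measure X) [IsFiniteMeasure P]
    [IsFiniteMeasure Q] {Z : Type*} [MeasurableSpace Z] (ν : Measure Y) [IsProbabilityMeasure ν]
    {h : X × Y → Z} (hh : Measurable h) :
    hsDiv α ((P.prod ν).map h) ((Q.prod ν).map h) ≤ hsDiv α P Q := by
  have : Nonempty {E : Set Z // MeasurableSet E} := ⟨⟨∅, .empty⟩⟩
  refine ciSup_le fun ⟨E, hE⟩ => ?_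
  have hm : Measurable fun x => ν (Prod.mk x ⁻¹' (h ⁻¹' E)) :=
    measurable_measure_prodMk_left (hh hE)
  have key (μ : Measure X) [IsFiniteMeasure μ] :
      ((μ.prod ν).map h E).toReal = ∫ x, ν.real (Prod.mk x ⁻¹' (h ⁻¹' E)) ∂μ := by
    rw [Measure.map_apply hh hE, Measure.prod_apply (hh hE)]
    exact (integral_toReal hm.aemeasurable (.of_forall fun _ => measure_lt_top _ _)).symm
  simp only [key]
  exact integral_sub_le_hsDiv hα P Q hm.ennreal_toReal (fun _ => measureReal_nonneg)
    fun _ => measureReal_le_one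

end HockeyStick

lemma gaussianReal_sq_eq (μ σ : ℝ) :
    gaussianReal μ ⟨σ ^ 2, sq_nonneg σ⟩ = gaussianReal μ (σ ^ 2).toNNReal :=
  congrArg _ (NNReal.eq (Real.coe_toNNReal _ (sq_nonneg σ)).symm)

lemma poissonGauss_eq_sum (σ γ : ℝ) {m : ℕ} (x : Fin m → ℝ) :
    poissonGauss σ γ x = ∑ S : Finset (Fin m),
      ENNReal.ofReal (γ ^ S.card * (1 - γ) ^ (m - S.card)) •
        gaussianReal (∑ i ∈ S, x i) (σ ^ 2).toNNReal := by
  simp only [poissonGauss, gaussianReal_sq_eq]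

lemma sum_poisson_weights {γ : ℝ} (hγ0 : 0 ≤ γ) (hγ1 : γ ≤ 1) (m : ℕ) :
    ∑ S : Finset (Fin m), ENNReal.ofReal (γ ^ S.card * (1 - γ) ^ (m - S.card)) = 1 := by
  have h1 : 0 ≤ 1 - γ := sub_nonneg.2 hγ1
  rw [← ENNReal.ofReal_sum_of_nonneg fun _ _ => by positivity, Fin.sum_pow_mul_eq_add_pow]
  simp

lemma isProbabilityMeasure_poissonGauss (σ : ℝ) {γ : ℝ} (hγ0 : 0 ≤ γ) (hγ1 : γ ≤ 1) {m : ℕ}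
    (x : Fin m → ℝ) : IsProbabilityMeasure (poissonGauss σ γ x) := by
  constructor
  simp [poissonGauss_eq_sum, sum_poisson_weights hγ0 hγ1]

lemma poissonGauss_zero (σ : ℝ) {γ : ℝ} (hγ0 : 0 ≤ γ) (hγ1 : γ ≤ 1) (m : ℕ) :
    poissonGauss σ γ (fun _ : Fin m => (0 : ℝ)) = gaussianReal 0 (σ ^ 2).toNNReal := by
  simp [poissonGauss_eq_sum, ← Finset.sum_smul, sum_poisson_weights hγ0 hγ1]

lemma Finset.sum_finset_fin_succAbove {M : Type*} [AddCommMonoid M] {m : ℕ} (i : Fin (m + 1))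
    (f : Finset (Fin (m + 1)) → M) :
    ∑ S, f S = ∑ S : Finset (Fin m), f (S.map i.succAboveEmb) +
      ∑ S : Finset (Fin m), f (insert i (S.map i.succAboveEmb)) := by
  have hinj : Function.Injective fun S : Finset (Fin m) => S.image i.succAboveEmb :=
    Finset.image_injective i.succAboveEmb.injective
  rw [← Finset.powerset_univ, Fin.univ_succAbove m i, Finset.cons_eq_insert,
    Finset.sum_powerset_insert (by simp), Finset.map_eq_image, Finset.powerset_image,
    Finset.sum_image hinj.injOn, Finset.sum_image hinj.injOn]
  simp [Finset.map_eq_image]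

/-- Conditioning the subsampled mechanism on whether the entry at position `i` is selected. -/
lemma poissonGauss_eq_add_map (σ : ℝ) {γ : ℝ} (hγ0 : 0 ≤ γ) (hγ1 : γ ≤ 1) {m : ℕ}
    {D : Fin m → ℝ} {D' : Fin (m + 1) → ℝ} {i : Fin (m + 1)}
    (h : ∀ j, D j = D' (i.succAbove j)) :
    poissonGauss σ γ D' = ENNReal.ofReal (1 - γ) • poissonGauss σ γ D +
      ENNReal.ofReal γ • (poissonGauss σ γ D).map (· + D' i) := by
  have h1 : 0 ≤ 1 - γ := sub_nonneg.2 hγ1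
  rw [poissonGauss_eq_sum, Finset.sum_finset_fin_succAbove i, poissonGauss_eq_sum,
    Measure.map_finset_sum' (by fun_prop), Finset.smul_sum, Finset.smul_sum]
  congr 1 <;> refine Finset.sum_congr rfl fun S _ => ?_
  · have hS : S.card ≤ m := by simpa using S.card_le_univ
    rw [smul_smul, ← ENNReal.ofReal_mul h1, Finset.sum_map, Finset.card_map,
      Nat.succ_sub hS, pow_succ]
    simp only [Fin.succAboveEmb_apply, ← h]
    congr 2
    ring
  · have hi : i ∉ S.map i.succAboveEmb := by simp
    rw [Measure.map_smul, gaussianReal_map_add_const, smul_smul, ← ENNReal.ofReal_mul hγ0,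
      Finset.sum_insert hi, Finset.card_insert_of_notMem hi, Finset.sum_map, Finset.card_map,
      Nat.add_sub_add_right, pow_succ]
    simp only [Fin.succAboveEmb_apply, ← h]
    rw [add_comm (D' i)]
    congr 2
    ring

/-- The Gaussian noise of the mechanism can be split into two independent parts. -/
lemma map_prod_poissonGauss {σ τ γ c : ℝ} (h : c ^ 2 * σ ^ 2 + τ ^ 2 = σ ^ 2) {m : ℕ}
    (D : Fin m → ℝ) (μ : ℝ) :
    ((gaussianReal μ (σ ^ 2).toNNReal).prod (poissonGauss τ γ D)).map
      (fun p => c * p.1 + p.2) = (poissonGauss σ γ D).map (· + c * μ) := by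
  have hsum (s : Finset (Finset (Fin m))) (w : Finset (Fin m) → ℝ≥0∞)
      (N : Finset (Fin m) → Measure ℝ) [∀ S, SFinite (N S)] (R : Measure ℝ) [SFinite R] :
      R.prod (∑ S ∈ s, w S • N S) = ∑ S ∈ s, w S • R.prod (N S) := by
    rw [← Measure.sum_coe_finset, ← Measure.sum_coe_finset, Measure.prod_sum_right]
    simp only [Measure.prod_smul_right]
  have hcomp (s : ℝ) : ((gaussianReal μ (σ ^ 2).toNNReal).prod
      (gaussianReal s (τ ^ 2).toNNReal)).map (fun p => c * p.1 + p.2) =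
      gaussianReal (s + c * μ) (σ ^ 2).toNNReal := by
    have hv : .mk (c ^ 2) (sq_nonneg c) * (σ ^ 2).toNNReal + (τ ^ 2).toNNReal =
        (σ ^ 2).toNNReal := NNReal.eq (by simpa [sq_nonneg] using h)
    have hconv : (gaussianReal (c * μ) (.mk (c ^ 2) (sq_nonneg c) * (σ ^ 2).toNNReal)) ∗
        (gaussianReal s (τ ^ 2).toNNReal) = gaussianReal (s + c * μ) (σ ^ 2).toNNReal := by
      rw [gaussianReal_conv_gaussianReal, hv, add_comm]
    rw [← hconv, ← gaussianReal_map_const_mul, Measure.conv]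
    nth_rw 2 [← Measure.map_id (μ := gaussianReal s _)]
    rw [Measure.map_prod_map _ _ (by fun_prop) (by fun_prop),
      Measure.map_map (by fun_prop) (by fun_prop)]
    rfl
  rw [poissonGauss_eq_sum, hsum, poissonGauss_eq_sum, Measure.map_finset_sum' (by fun_prop),
    Measure.map_finset_sum' (by fun_prop)]
  simp only [Measure.map_smul, hcomp, gaussianReal_map_add_const]

/-- Dominating pair of datasets for the Poisson-subsampled Gaussian mechanism under the add
relation: for datasets with entries in `[−1,1]` where `D'` is `D` with one entry inserted,
`H_α(Mγ(D) ‖ Mγ(D')) ≤ H_α(N(0,σ²) ‖ (1−γ)N(0,σ²) + γN(1,σ²))` for all `α ≥ 0`, and the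
bound is realized by `D = (0,…,0)`, `D' = (0,…,0,1)`. -/
theorem poissonGauss_dominating_pair_add (σ γ : ℝ) (hσ : 0 < σ) (hγ0 : 0 ≤ γ) (hγ1 : γ ≤ 1) :
    (∀ (m : ℕ) (D : Fin m → ℝ) (D' : Fin (m + 1) → ℝ),
      (∀ j, D j ∈ Set.Icc (-1 : ℝ) 1) → (∀ j, D' j ∈ Set.Icc (-1 : ℝ) 1) →
      (∃ i : Fin (m + 1), ∀ j : Fin m, D j = D' (i.succAbove j)) →
      ∀ α : ℝ, 0 ≤ α →
        hsDiv α (poissonGauss σ γ D) (poissonGauss σ γ D') ≤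
          hsDiv α (gaussianReal 0 ⟨σ ^ 2, sq_nonneg σ⟩)
            (ENNReal.ofReal (1 - γ) • gaussianReal 0 ⟨σ ^ 2, sq_nonneg σ⟩ +
              ENNReal.ofReal γ • gaussianReal 1 ⟨σ ^ 2, sq_nonneg σ⟩)) ∧
    (∀ m : ℕ,
      poissonGauss σ γ (fun _ : Fin m => (0 : ℝ)) = gaussianReal 0 ⟨σ ^ 2, sq_nonneg σ⟩ ∧
      poissonGauss σ γ (Fin.snoc (fun _ : Fin m => (0 : ℝ)) 1) =
        ENNReal.ofReal (1 - γ) • gaussianReal 0 ⟨σ ^ 2, sq_nonneg σ⟩ +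
          ENNReal.ofReal γ • gaussianReal 1 ⟨σ ^ 2, sq_nonneg σ⟩) := by
  simp only [gaussianReal_sq_eq]
  refine ⟨?_, fun m => ⟨poissonGauss_zero σ hγ0 hγ1 m, ?_⟩⟩
  · rintro m D D' - hD' ⟨i, hi⟩ α hα
    set c := D' i
    set N := gaussianReal 0 (σ ^ 2).toNNReal
    set N₁ := gaussianReal 1 (σ ^ 2).toNNReal
    have hc2 : 0 ≤ 1 - c ^ 2 := by nlinarith [(hD' i).1, (hD' i).2]
    have hτ : c ^ 2 * σ ^ 2 + (σ * √(1 - c ^ 2)) ^ 2 = σ ^ 2 := by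
      rw [mul_pow, Real.sq_sqrt hc2]; ring
    have := isProbabilityMeasure_poissonGauss (σ * √(1 - c ^ 2)) hγ0 hγ1 D
    have hP := map_prod_poissonGauss (D := D) (γ := γ) hτ 0
    have hP₁ := map_prod_poissonGauss (D := D) (γ := γ) hτ 1
    simp only [mul_zero, add_zero, Measure.map_id', mul_one] at hP hP₁
    have hfin (a : ℝ) (R : Measure ℝ) [IsFiniteMeasure R] :
        IsFiniteMeasure (ENNReal.ofReal a • R) := R.smul_finite ENNReal.ofReal_ne_top
    have := hfin γ N₁
    have := hfin (1 - γ) N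
    have hmeas : Measurable fun p : ℝ × ℝ => c * p.1 + p.2 := by fun_prop
    have hQ : poissonGauss σ γ D' =
        ((ENNReal.ofReal (1 - γ) • N + ENNReal.ofReal γ • N₁).prod
          (poissonGauss (σ * √(1 - c ^ 2)) γ D)).map (fun p => c * p.1 + p.2) := by
      rw [poissonGauss_eq_add_map σ hγ0 hγ1 hi, Measure.add_prod, Measure.prod_smul_left,
        Measure.prod_smul_left, Measure.map_add _ _ hmeas, Measure.map_smul, Measure.map_smul,
        hP, hP₁]
    rw [hQ, ← hP]
    exact hsDiv_map_prod_le hα _ _ _ hmeas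
  · rw [poissonGauss_eq_add_map σ hγ0 hγ1 (D := fun _ : Fin m => (0 : ℝ)) (i := Fin.last m)
      fun j => by simp, poissonGauss_zero σ hγ0 hγ1]
    simp [gaussianReal_map_add_const]
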